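/- There exists a constant C > 0, depending only on τ₁, τ₂, and ε, such that for every a ∈ (0, min(τ₁, τ₂)/2) the following holds: if v : ℝ² → ℂ is a transmission function (for this a) which is doubly periodic, i.e. v(r + (τ₁, 0)) = v(r) and v(r + (0, τ₂)) = v(r) for all r ∈ ℝ², and has zero mean ∫_S v = 0, then ∫_S (|v|² + |∂ₓv|² + |∂ᵧv|²) ≤ C · ∫_S |(1/ε̃)·Δv|², where Δv is computed on ℝ² ∖ ∂D (the circles ∂D form a Lebesgue-null set). -/

import Mathlib

open MeasureTheory Set
open scoped Classical

/-- The lattice `L = {(m·τ₁, n·τ₂) : m, n ∈ ℤ}` of centers in `ℝ²`. -/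
def centers (τ₁ τ₂ : ℝ) : Set (ℝ × ℝ) := {p | ∃ m n : ℤ, p = (m * τ₁, n * τ₂)}

/-- `D`: the union of the open Euclidean disks of radius `a` centered at the
lattice points. -/
def disks (τ₁ τ₂ a : ℝ) : Set (ℝ × ℝ) :=
  {q | ∃ p ∈ centers τ₁ τ₂, (q.1 - p.1) ^ 2 + (q.2 - p.2) ^ 2 < a ^ 2}

/-- The piecewise dielectric constant `ε̃`, equal to `ε` on `D` and `1` elsewhere. -/
noncomputable def epsTilde (τ₁ τ₂ a ε : ℝ) (q : ℝ × ℝ) : ℝ :=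
  if q ∈ disks τ₁ τ₂ a then ε else 1

/-- The fundamental cell `S = [−τ₁/2, τ₁/2] × [−τ₂/2, τ₂/2]`. -/
def cell (τ₁ τ₂ : ℝ) : Set (ℝ × ℝ) :=
  Icc (-τ₁ / 2) (τ₁ / 2) ×ˢ Icc (-τ₂ / 2) (τ₂ / 2)

/-- The Laplacian `Δf = ∂²f/∂x² + ∂²f/∂y²` of `f : ℝ² → ℂ`. -/
noncomputable def lap (f : ℝ × ℝ → ℂ) (q : ℝ × ℝ) : ℂ :=
  fderiv ℝ (fun p => fderiv ℝ f p (1, 0)) q (1, 0) +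
    fderiv ℝ (fun p => fderiv ℝ f p (0, 1)) q (0, 1)

/-- `u` is a transmission function with pieces `Uin`, `Uex`: `Uin` is `C²` on a
neighborhood of the closed disks, `Uex` is `C²` on a neighborhood of the
complement of the open disks, `u` is glued from them, the pieces agree on the
circles, and the normal (radial) derivatives satisfy
`(1/ε)·∂Uin/∂n = ∂Uex/∂n` there. -/
structure IsTransmission (τ₁ τ₂ a ε : ℝ) (u Uin Uex : ℝ × ℝ → ℂ) : Prop where
  smooth_in : ∃ N : Set (ℝ × ℝ), IsOpen N ∧ closure (disks τ₁ τ₂ a) ⊆ N ∧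
    ContDiffOn ℝ 2 Uin N
  smooth_ex : ∃ N : Set (ℝ × ℝ), IsOpen N ∧ (disks τ₁ τ₂ a)ᶜ ⊆ N ∧
    ContDiffOn ℝ 2 Uex N
  eq_in : ∀ q ∈ disks τ₁ τ₂ a, u q = Uin q
  eq_ex : ∀ q ∉ disks τ₁ τ₂ a, u q = Uex q
  continuity : ∀ p ∈ centers τ₁ τ₂, ∀ q : ℝ × ℝ,
    (q.1 - p.1) ^ 2 + (q.2 - p.2) ^ 2 = a ^ 2 → Uin q = Uex q
  flux : ∀ p ∈ centers τ₁ τ₂, ∀ q : ℝ × ℝ,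
    (q.1 - p.1) ^ 2 + (q.2 - p.2) ^ 2 = a ^ 2 →
      (1 / ε : ℂ) * fderiv ℝ Uin q (q.1 - p.1, q.2 - p.2) =
        fderiv ℝ Uex q (q.1 - p.1, q.2 - p.2)


section Poincare

lemma sq_integral_le_measureReal_mul {α : Type*} [MeasurableSpace α] {μ : Measure α}
    [IsFiniteMeasure μ] {f : α → ℝ} (hf : Integrable f μ) (hf2 : Integrable (fun x => f x ^ 2) μ) :
    (∫ x, f x ∂μ) ^ 2 ≤ μ.real univ * ∫ x, f x ^ 2 ∂μ := by
  set m := μ.real univ with hm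
  set I := ∫ x, f x ∂μ with hI
  have key : ∫ x, (m * f x - I) ^ 2 ∂μ = m * (m * (∫ x, f x ^ 2 ∂μ) - I ^ 2) := by
    have e : (fun x => (m * f x - I) ^ 2)
        = fun x => (m ^ 2 * f x ^ 2 - (2 * m * I) * f x) + I ^ 2 := by
      funext x; ring
    have i1 : Integrable (fun x => m ^ 2 * f x ^ 2 - (2 * m * I) * f x) μ :=
      (hf2.const_mul _).sub (hf.const_mul _)
    rw [e, integral_add i1 (integrable_const _), integral_sub (hf2.const_mul _) (hf.const_mul _),
      integral_const_mul, integral_const_mul, integral_const, smul_eq_mul, ← hI, ← hm]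
    ring
  have h0 : 0 ≤ m * (m * (∫ x, f x ^ 2 ∂μ) - I ^ 2) := by
    rw [← key]; exact integral_nonneg fun x => sq_nonneg _
  rcases eq_or_lt_of_le (measureReal_nonneg : 0 ≤ m) with h | h
  · have hz : μ = 0 := by
      have : μ univ = 0 := by
        simpa [hm, measureReal_def, ENNReal.toReal_eq_zero_iff] using h.symm
      exact Measure.measure_univ_eq_zero.1 this
    simp [hI, hz]
  · have := nonneg_of_mul_nonneg_right h0 h
    linarith

/-- The oscillation of a function on an interval is at most the `L¹` norm of its derivative. -/
lemma norm_sub_le_integral_norm_deriv {f f' : ℝ → ℂ} {l u : ℝ} {E : Set ℝ} (hE : E.Countable)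
    (hc : ContinuousOn f (Icc l u)) (hd : ∀ x ∈ Icc l u, x ∉ E → HasDerivAt f (f' x) x)
    (hi : IntegrableOn f' (Icc l u)) {x x' : ℝ} (hx : x ∈ Icc l u) (hx' : x' ∈ Icc l u) :
    ‖f x - f x'‖ ≤ ∫ s in Icc l u, ‖f' s‖ := by
  have hsub : uIcc x' x ⊆ Icc l u := uIcc_subset_Icc hx' hx
  have h := integral_eq_of_hasDerivAt_off_countable f f' hE (hc.mono hsub)
    (fun t ht => hd t (hsub (Ioo_subset_Icc_self ht.1)) ht.2)
    ((hi.mono_set hsub).intervalIntegrable)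
  rw [← h]
  refine intervalIntegral.norm_integral_le_integral_norm_uIoc.trans ?_
  exact setIntegral_mono_set hi.norm (Filter.Eventually.of_forall fun _ => norm_nonneg _)
    (uIoc_subset_uIcc.trans hsub).eventuallyLE

lemma measure_eq_zero_of_countable_slices {E : Set (ℝ × ℝ)} (hEm : MeasurableSet E)
    (hE : ∀ x, {y | (x, y) ∈ E}.Countable) : volume E = 0 := by
  rw [Measure.volume_eq_prod, Measure.measure_prod_null hEm]
  exact Filter.Eventually.of_forall fun x => (hE x).measure_zero _

lemma ae_notMem_of_countable_slices {E : Set (ℝ × ℝ)} (hEm : MeasurableSet E)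
    (hE : ∀ x, {y | (x, y) ∈ E}.Countable) (R : Set (ℝ × ℝ)) :
    ∀ᵐ q ∂(volume.restrict R), q ∉ E :=
  ae_restrict_of_ae (measure_eq_zero_iff_ae_notMem.1 (measure_eq_zero_of_countable_slices hEm hE))

/-- **Poincaré inequality** on a rectangle for continuous functions which are differentiable with
bounded derivative away from a set with countable slices. -/
lemma poincare_rectangle {w : ℝ × ℝ → ℂ} {l₁ u₁ l₂ u₂ M : ℝ} {E : Set (ℝ × ℝ)} (h₁ : l₁ < u₁)
    (h₂ : l₂ < u₂) (hEm : MeasurableSet E) (hE₁ : ∀ y, {x | (x, y) ∈ E}.Countable)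
    (hE₂ : ∀ x, {y | (x, y) ∈ E}.Countable) (hc : ContinuousOn w (Icc l₁ u₁ ×ˢ Icc l₂ u₂))
    (hd : ∀ q ∈ Icc l₁ u₁ ×ˢ Icc l₂ u₂, q ∉ E → DifferentiableAt ℝ w q)
    (hb₁ : ∀ q ∈ Icc l₁ u₁ ×ˢ Icc l₂ u₂, q ∉ E → ‖fderiv ℝ w q (1, 0)‖ ≤ M)
    (hb₂ : ∀ q ∈ Icc l₁ u₁ ×ˢ Icc l₂ u₂, q ∉ E → ‖fderiv ℝ w q (0, 1)‖ ≤ M)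
    (h0 : ∫ q in Icc l₁ u₁ ×ˢ Icc l₂ u₂, w q = 0) :
    ∫ q in Icc l₁ u₁ ×ˢ Icc l₂ u₂, ‖w q‖ ^ 2 ≤
      2 * (u₁ - l₁) ^ 2 * (∫ q in Icc l₁ u₁ ×ˢ Icc l₂ u₂, ‖fderiv ℝ w q (1, 0)‖ ^ 2) +
      2 * (u₂ - l₂) ^ 2 * ∫ q in Icc l₁ u₁ ×ˢ Icc l₂ u₂, ‖fderiv ℝ w q (0, 1)‖ ^ 2 := by
  set R := Icc l₁ u₁ ×ˢ Icc l₂ u₂ with hR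
  have hRm : MeasurableSet R := measurableSet_Icc.prod measurableSet_Icc
  have hRc : IsCompact R := isCompact_Icc.prod isCompact_Icc
  set μ := (volume : Measure ℝ).restrict (Icc l₁ u₁) with hμ
  set ν := (volume : Measure ℝ).restrict (Icc l₂ u₂) with hν
  have hvol : (volume : Measure (ℝ × ℝ)).restrict R = μ.prod ν := by
    rw [hμ, hν, Measure.prod_restrict, ← Measure.volume_eq_prod]
  have hμ1 : μ.real univ = u₁ - l₁ := by
    simp [hμ, measureReal_def, ENNReal.toReal_ofReal (sub_pos.2 h₁).le]
  have hν1 : ν.real univ = u₂ - l₂ := by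
    simp [hν, measureReal_def, ENNReal.toReal_ofReal (sub_pos.2 h₂).le]
  have hT1 : 0 < u₁ - l₁ := sub_pos.2 h₁
  have hT2 : 0 < u₂ - l₂ := sub_pos.2 h₂
  set p : ℝ × ℝ → ℂ := fun q => fderiv ℝ w q (1, 0) with hp
  set r : ℝ × ℝ → ℂ := fun q => fderiv ℝ w q (0, 1) with hr
  have hpm : Measurable p := measurable_fderiv_apply_const ℝ w _
  have hrm : Measurable r := measurable_fderiv_apply_const ℝ w _
  have hae : ∀ᵐ q ∂(μ.prod ν), q ∈ R ∧ q ∉ E := by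
    rw [← hvol]
    filter_upwards [ae_restrict_mem hRm, ae_notMem_of_countable_slices hEm hE₂ R] with q h h'
    exact ⟨h, h'⟩
  have hpi : Integrable p (μ.prod ν) := Integrable.of_bound hpm.aestronglyMeasurable M
    (hae.mono fun q hq => hb₁ q hq.1 hq.2)
  have hri : Integrable r (μ.prod ν) := Integrable.of_bound hrm.aestronglyMeasurable M
    (hae.mono fun q hq => hb₂ q hq.1 hq.2)
  have hp2 : Integrable (fun q => ‖p q‖ ^ 2) (μ.prod ν) :=
    Integrable.of_bound (hpm.norm.pow_const 2).aestronglyMeasurable (M ^ 2)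
    (hae.mono fun q hq => by
      rw [norm_pow, norm_norm]; exact pow_le_pow_left₀ (norm_nonneg _) (hb₁ q hq.1 hq.2) 2)
  have hr2 : Integrable (fun q => ‖r q‖ ^ 2) (μ.prod ν) :=
    Integrable.of_bound (hrm.norm.pow_const 2).aestronglyMeasurable (M ^ 2)
    (hae.mono fun q hq => by
      rw [norm_pow, norm_norm]; exact pow_le_pow_left₀ (norm_nonneg _) (hb₂ q hq.1 hq.2) 2)
  have hps : ∀ y ∈ Icc l₂ u₂, ∀ᵐ x ∂μ, ‖p (x, y)‖ ≤ M := by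
    intro y hy
    filter_upwards [ae_restrict_mem measurableSet_Icc,
      ae_restrict_of_ae ((hE₁ y).ae_notMem volume)] with x hx hxE
    exact hb₁ _ ⟨hx, hy⟩ hxE
  have hrs : ∀ x ∈ Icc l₁ u₁, ∀ᵐ y ∂ν, ‖r (x, y)‖ ≤ M := by
    intro x hx
    filter_upwards [ae_restrict_mem measurableSet_Icc,
      ae_restrict_of_ae ((hE₂ x).ae_notMem volume)] with y hy hyE
    exact hb₂ _ ⟨hx, hy⟩ hyE
  have hpsi : ∀ y ∈ Icc l₂ u₂, Integrable (fun x => p (x, y)) μ := fun y hy =>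
    Integrable.of_bound (hpm.comp measurable_prodMk_right).aestronglyMeasurable M (hps y hy)
  have hrsi : ∀ x ∈ Icc l₁ u₁, Integrable (fun y => r (x, y)) ν := fun x hx =>
    Integrable.of_bound (hrm.comp measurable_prodMk_left).aestronglyMeasurable M (hrs x hx)
  have hpsi2 : ∀ y ∈ Icc l₂ u₂, Integrable (fun x => ‖p (x, y)‖ ^ 2) μ := fun y hy =>
    Integrable.of_bound
      ((hpm.comp measurable_prodMk_right).norm.pow_const 2).aestronglyMeasurable (M ^ 2)
      ((hps y hy).mono fun x hx => by
        rw [norm_pow, norm_norm]; exact pow_le_pow_left₀ (norm_nonneg _) hx 2)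
  have hosc : ∀ q ∈ R, ∀ q' ∈ R,
      ‖w q - w q'‖ ≤ (∫ s, ‖p (s, q.2)‖ ∂μ) + ∫ t, ‖r (q'.1, t)‖ ∂ν := by
    rintro ⟨x, y⟩ ⟨hx, hy⟩ ⟨x', y'⟩ ⟨hx', hy'⟩
    have e1 := norm_sub_le_integral_norm_deriv (f := fun s => w (s, y)) (f' := fun s => p (s, y))
      (hE₁ y) (hc.comp (by fun_prop) fun s hs => ⟨hs, hy⟩)
      (fun s hs hsE => by
        have := (hd (s, y) ⟨hs, hy⟩ hsE).hasFDerivAt.comp_hasDerivAt s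
          ((hasDerivAt_id s).prodMk (hasDerivAt_const s y))
        exact this)
      (hpsi y hy) hx hx'
    have e2 := norm_sub_le_integral_norm_deriv (f := fun t => w (x', t))
      (f' := fun t => r (x', t))
      (hE₂ x') (hc.comp (by fun_prop) fun s hs => ⟨hx', hs⟩)
      (fun s hs hsE => by
        have := (hd (x', s) ⟨hx', hs⟩ hsE).hasFDerivAt.comp_hasDerivAt s
          ((hasDerivAt_const s x').prodMk (hasDerivAt_id s))
        exact this)
      (hrsi x' hx') hy hy'
    calc ‖w (x, y) - w (x', y')‖ = ‖(w (x, y) - w (x', y)) + (w (x', y) - w (x', y'))‖ := by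
          ring_nf
      _ ≤ _ := norm_add_le _ _
      _ ≤ _ := add_le_add e1 e2
  have hwi : Integrable w (μ.prod ν) := by
    rw [← hvol]; exact hc.integrableOn_compact hRc
  have hw2 : Integrable (fun q => ‖w q‖ ^ 2) (μ.prod ν) := by
    rw [← hvol]; exact (hc.norm.pow 2).integrableOn_compact hRc
  set G := ∫ q, ‖r q‖ ∂(μ.prod ν) with hG
  have hG' : G = ∫ x, ∫ t, ‖r (x, t)‖ ∂ν ∂μ := integral_prod _ hri.norm
  have hvR : (μ.prod ν).real univ = (u₁ - l₁) * (u₂ - l₂) := by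
    rw [← hμ1, ← hν1, measureReal_def, measureReal_def, measureReal_def, ← univ_prod_univ,
      Measure.prod_prod, ENNReal.toReal_mul]
  have hpt : ∀ q ∈ R, ‖w q‖ ≤ (∫ s, ‖p (s, q.2)‖ ∂μ) + G / (u₁ - l₁) := by
    intro q hq
    have hbi : Integrable (fun q' : ℝ × ℝ => ∫ t, ‖r (q'.1, t)‖ ∂ν) (μ.prod ν) :=
      (hri.norm.integral_prod_left).comp_fst ν
    have e1 : ∫ q', (w q - w q') ∂(μ.prod ν) = ((u₁ - l₁) * (u₂ - l₂)) • w q := by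
      rw [integral_sub (integrable_const _) hwi, integral_const, hvR, ← hvol, h0, sub_zero]
    have e2 : ‖∫ q', (w q - w q') ∂(μ.prod ν)‖ ≤
        ∫ q', ((∫ s, ‖p (s, q.2)‖ ∂μ) + ∫ t, ‖r (q'.1, t)‖ ∂ν) ∂(μ.prod ν) :=
      norm_integral_le_of_norm_le ((integrable_const _).add hbi)
        (hae.mono fun q' hq' => hosc q hq q' hq'.1)
    rw [e1, integral_add (integrable_const _) hbi, integral_const,
      integral_fun_fst (fun x => ∫ t, ‖r (x, t)‖ ∂ν), ← hG', hvR, hν1, norm_smul, smul_eq_mul,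
      smul_eq_mul, Real.norm_of_nonneg (mul_pos hT1 hT2).le] at e2
    have : (u₁ - l₁) * (u₂ - l₂) * ‖w q‖ ≤
        (u₁ - l₁) * (u₂ - l₂) * ((∫ s, ‖p (s, q.2)‖ ∂μ) + G / (u₁ - l₁)) := by
      refine e2.trans (le_of_eq ?_)
      field_simp
    exact le_of_mul_le_mul_left this (mul_pos hT1 hT2)
  have hG2 : G ^ 2 ≤ (u₁ - l₁) * (u₂ - l₂) * ∫ q, ‖r q‖ ^ 2 ∂(μ.prod ν) := by
    rw [← hvR]; exact sq_integral_le_measureReal_mul hri.norm hr2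
  have hA : Integrable (fun q : ℝ × ℝ => ∫ s, ‖p (s, q.2)‖ ^ 2 ∂μ) (μ.prod ν) :=
    (hp2.integral_prod_right).comp_snd μ
  have hpt2 : ∀ q ∈ R, ‖w q‖ ^ 2 ≤ 2 * (u₁ - l₁) * (∫ s, ‖p (s, q.2)‖ ^ 2 ∂μ) +
      2 * (u₂ - l₂) / (u₁ - l₁) * ∫ q, ‖r q‖ ^ 2 ∂(μ.prod ν) := by
    intro q hq
    have e1 := sq_integral_le_measureReal_mul (hpsi q.2 hq.2).norm (hpsi2 q.2 hq.2)
    rw [hμ1] at e1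
    have e2 : (G / (u₁ - l₁)) ^ 2 ≤
        (u₂ - l₂) / (u₁ - l₁) * ∫ q, ‖r q‖ ^ 2 ∂(μ.prod ν) := by
      rw [div_pow, div_le_iff₀ (by positivity)]
      refine hG2.trans (le_of_eq ?_)
      field_simp
    have e3 := pow_le_pow_left₀ (norm_nonneg _) (hpt q hq) 2
    have e4 := add_sq_le (a := ∫ s, ‖p (s, q.2)‖ ∂μ) (b := G / (u₁ - l₁))
    have e5 : 2 * (u₂ - l₂) / (u₁ - l₁) * ∫ q, ‖r q‖ ^ 2 ∂(μ.prod ν) =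
      2 * ((u₂ - l₂) / (u₁ - l₁) * ∫ q, ‖r q‖ ^ 2 ∂(μ.prod ν)) := by ring
    rw [e5]
    linarith
  have hfin := integral_mono_ae hw2 ((hA.const_mul (2 * (u₁ - l₁))).add (integrable_const
    (2 * (u₂ - l₂) / (u₁ - l₁) * ∫ q, ‖r q‖ ^ 2 ∂(μ.prod ν))))
    (hae.mono fun q hq => hpt2 q hq.1)
  simp only [Pi.add_apply] at hfin
  rw [integral_add (hA.const_mul _) (integrable_const _), integral_const_mul,
    integral_fun_snd (fun y => ∫ s, ‖p (s, y)‖ ^ 2 ∂μ), ← integral_prod_symm _ hp2,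
    integral_const, hvR, hμ1, smul_eq_mul, smul_eq_mul] at hfin
  rw [hvol]
  refine hfin.trans (le_of_eq ?_)
  field_simp
  rfl

end Poincare

section Disk

/-- The squared Euclidean distance to the origin. -/
def sqRadius (q : ℝ × ℝ) : ℝ := q.1 ^ 2 + q.2 ^ 2

lemma continuous_sqRadius : Continuous sqRadius := by
  unfold sqRadius; fun_prop

lemma norm_sq_le_sqRadius (q : ℝ × ℝ) : ‖q‖ ^ 2 ≤ sqRadius q := by
  unfold sqRadius
  rcases max_cases ‖q.1‖ ‖q.2‖ with h | h
  · rw [Prod.norm_def, h.1, Real.norm_eq_abs, sq_abs]; nlinarith [sq_nonneg q.2]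
  · rw [Prod.norm_def, h.1, Real.norm_eq_abs, sq_abs]; nlinarith [sq_nonneg q.1]

lemma isCompact_sqRadius_le (c : ℝ) : IsCompact {q | sqRadius q ≤ c} := by
  refine (isCompact_closedBall (0 : ℝ × ℝ) (|c| + 1)).of_isClosed_subset
    (isClosed_le continuous_sqRadius continuous_const) fun q hq => ?_
  rw [mem_closedBall_zero_iff]
  have h1 := norm_sq_le_sqRadius q
  have h2 : sqRadius q ≤ c := hq
  nlinarith [norm_nonneg q, le_abs_self c, abs_nonneg c]

lemma isCompact_annulus (b c : ℝ) : IsCompact {q | b ≤ sqRadius q ∧ sqRadius q ≤ c} :=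
  (isCompact_sqRadius_le c).of_isClosed_subset
    ((isClosed_le continuous_const continuous_sqRadius).inter
      (isClosed_le continuous_sqRadius continuous_const)) fun _ hq => hq.2

lemma finite_setOf_sq_eq (c : ℝ) : {x : ℝ | x ^ 2 = c}.Finite := by
  refine (Set.toFinite {√c, -√c}).subset fun x hx => ?_
  have hx : x ^ 2 = c := hx
  have h : x ^ 2 = √c ^ 2 := by rw [Real.sq_sqrt (hx ▸ sq_nonneg x), hx]
  simpa using sq_eq_sq_iff_eq_or_eq_neg.1 h

lemma measurableSet_circle (c : ℝ) : MeasurableSet {q | sqRadius q = c} :=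
  (isClosed_eq continuous_sqRadius continuous_const).measurableSet

lemma countable_circle_slice_fst (c y : ℝ) : {x | (x, y) ∈ {q | sqRadius q = c}}.Countable := by
  refine ((finite_setOf_sq_eq (c - y ^ 2)).subset fun x hx => ?_).countable
  have hx : x ^ 2 + y ^ 2 = c := hx
  exact eq_sub_of_add_eq hx

lemma countable_circle_slice_snd (c x : ℝ) : {y | (x, y) ∈ {q | sqRadius q = c}}.Countable := by
  refine ((finite_setOf_sq_eq (c - x ^ 2)).subset fun y hy => ?_).countable
  have hy : x ^ 2 + y ^ 2 = c := hy
  exact eq_sub_of_add_eq' hy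

lemma ae_sqRadius_ne (c : ℝ) (R : Set (ℝ × ℝ)) :
    ∀ᵐ q ∂((volume : Measure (ℝ × ℝ)).restrict R), sqRadius q ≠ c :=
  ae_notMem_of_countable_slices (measurableSet_circle c) (countable_circle_slice_snd c) R

/-- An open set containing a closed disk contains a slightly larger one. -/
lemma exists_larger_disk_subset {N : Set (ℝ × ℝ)} {c : ℝ} (hN : IsOpen N)
    (h : ∀ q, sqRadius q ≤ c → q ∈ N) : ∃ δ > 0, ∀ q, sqRadius q ≤ c + δ → q ∈ N := by
  set K := {q | sqRadius q ≤ c + 1} \ N with hK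
  have hKc : IsCompact K := (isCompact_sqRadius_le _).diff hN
  rcases K.eq_empty_or_nonempty with h0 | h0
  · refine ⟨1, one_pos, fun q hq => ?_⟩
    by_contra hqN
    have : q ∈ K := ⟨hq, hqN⟩
    simp [h0] at this
  · obtain ⟨q₀, hq₀, hmin⟩ := hKc.exists_isMinOn h0 continuous_sqRadius.continuousOn
    have hlt : c < sqRadius q₀ := lt_of_not_ge fun hle => hq₀.2 (h _ hle)
    have hle : sqRadius q₀ ≤ c + 1 := hq₀.1
    refine ⟨(sqRadius q₀ - c) / 2, by linarith, fun q hq => ?_⟩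
    by_contra hqN
    have : sqRadius q₀ ≤ sqRadius q :=
      hmin (show q ∈ K from ⟨show sqRadius q ≤ c + 1 by linarith, hqN⟩)
    linarith

/-- A `C¹` function vanishing on a circle grows at most linearly away from it. -/
lemma exists_abs_le_mul_sqRadius_sub {W : Set (ℝ × ℝ)} (hW : IsOpen W) {h : ℝ × ℝ → ℝ}
    (hh : ContDiffOn ℝ 1 h W) {a c : ℝ} (ha : 0 < a)
    (hK : ∀ q, a ^ 2 ≤ sqRadius q → sqRadius q ≤ c → q ∈ W)
    (h0 : ∀ q, sqRadius q = a ^ 2 → h q = 0) :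
    ∃ M, 0 ≤ M ∧ ∀ q, a ^ 2 ≤ sqRadius q → sqRadius q ≤ c → |h q| ≤ M * (sqRadius q - a ^ 2) := by
  have hcont : ContinuousOn (fderiv ℝ h) {q | a ^ 2 ≤ sqRadius q ∧ sqRadius q ≤ c} :=
    (hh.continuousOn_fderiv_of_isOpen hW le_rfl).mono fun q hq => hK q hq.1 hq.2
  obtain ⟨M, hM⟩ := (isCompact_annulus (a ^ 2) c).exists_bound_of_continuousOn hcont
  refine ⟨|M| / a, by positivity, fun q hq1 hq2 => ?_⟩
  have hs0 : 0 < sqRadius q := lt_of_lt_of_le (by positivity) hq1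
  set ρ := √(sqRadius q) with hρ
  have hρ2 : ρ ^ 2 = sqRadius q := Real.sq_sqrt hs0.le
  have hρ0 : 0 < ρ := Real.sqrt_pos.2 hs0
  have haρ : a ≤ ρ := by nlinarith
  have hscale : ∀ t : ℝ, sqRadius (t • q) = t ^ 2 * sqRadius q := by
    intro t; simp [sqRadius]; ring
  set q₀ := (a / ρ) • q with hq0
  have hs : sqRadius q₀ = a ^ 2 := by
    rw [hq0, hscale, ← hρ2]; field_simp
  have hseg : ∀ z ∈ segment ℝ q₀ q, a ^ 2 ≤ sqRadius z ∧ sqRadius z ≤ c := by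
    rintro z ⟨α, β, hα, hβ, hαβ, rfl⟩
    have e : α • q₀ + β • q = (α * (a / ρ) + β) • q := by
      rw [hq0, add_smul, mul_smul]
    have h1 : a / ρ ≤ 1 := (div_le_one hρ0).2 haρ
    have h2 : a / ρ ≤ α * (a / ρ) + β := by nlinarith
    have h3 : α * (a / ρ) + β ≤ 1 := by nlinarith
    have h4 : 0 ≤ a / ρ := by positivity
    have h5 : a ^ 2 = (a / ρ) ^ 2 * sqRadius q := by rw [← hs, hq0, hscale]
    rw [e, hscale]
    constructor
    · rw [h5]; gcongr
    · refine le_trans ?_ hq2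
      exact mul_le_of_le_one_left hs0.le (pow_le_one₀ (h4.trans h2) h3)
  have hmv := (convex_segment q₀ q).norm_image_sub_le_of_norm_fderiv_le (f := h) (𝕜 := ℝ)
    (fun z hz => (hh.differentiableOn one_ne_zero).differentiableAt
      (hW.mem_nhds (hK z (hseg z hz).1 (hseg z hz).2)))
    (fun z hz => (hM z (hseg z hz)).trans (le_abs_self M))
    (left_mem_segment ℝ q₀ q) (right_mem_segment ℝ q₀ q)
  rw [h0 q₀ hs, sub_zero, Real.norm_eq_abs] at hmv
  have hn : ‖q - q₀‖ ≤ ρ - a := by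
    have e : q - q₀ = (1 - a / ρ) • q := by rw [hq0, sub_smul, one_smul]
    have h1 : 0 ≤ 1 - a / ρ := sub_nonneg.2 ((div_le_one hρ0).2 haρ)
    have h2 : ‖q‖ ≤ ρ := Real.le_sqrt_of_sq_le (norm_sq_le_sqRadius q)
    rw [e, norm_smul, Real.norm_of_nonneg h1]
    calc (1 - a / ρ) * ‖q‖ ≤ (1 - a / ρ) * ρ := by gcongr
      _ = ρ - a := by field_simp
  calc |h q| ≤ |M| * ‖q - q₀‖ := hmv
    _ ≤ |M| * (ρ - a) := by gcongr
    _ ≤ |M| * ((sqRadius q - a ^ 2) / a) := by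
        gcongr
        rw [le_div_iff₀ ha, ← hρ2]; nlinarith
    _ = |M| / a * (sqRadius q - a ^ 2) := by ring

end Disk

section Cutoff

/-- A smooth radial cutoff, equal to `1` on the disk of radius `a` and to `0` outside the disk of
squared radius `a ^ 2 + δ`. -/
noncomputable def diskCutoff (a δ : ℝ) (q : ℝ × ℝ) : ℝ :=
  Real.smoothTransition (1 + (a ^ 2 - sqRadius q) / δ)

lemma diskCutoff_eq_one {a δ : ℝ} (hδ : 0 < δ) {q : ℝ × ℝ} (hq : sqRadius q ≤ a ^ 2) :
    diskCutoff a δ q = 1 := by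
  refine Real.smoothTransition.one_of_one_le ?_
  have : 0 ≤ (a ^ 2 - sqRadius q) / δ := div_nonneg (by linarith) hδ.le
  linarith

lemma diskCutoff_eq_zero {a δ : ℝ} (hδ : 0 < δ) {q : ℝ × ℝ} (hq : a ^ 2 + δ ≤ sqRadius q) :
    diskCutoff a δ q = 0 := by
  refine Real.smoothTransition.zero_of_nonpos ?_
  have : (a ^ 2 - sqRadius q) / δ ≤ -1 := by
    rw [div_le_iff₀ hδ]; linarith
  linarith

lemma hasFDerivAt_diskCutoff (a δ : ℝ) (q : ℝ × ℝ) :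
    HasFDerivAt (diskCutoff a δ)
      (deriv Real.smoothTransition (1 + (a ^ 2 - sqRadius q) / δ) •
        ((-2 / δ) • (q.1 • ContinuousLinearMap.fst ℝ ℝ ℝ + q.2 • ContinuousLinearMap.snd ℝ ℝ ℝ)))
      q := by
  have hk : HasFDerivAt (fun q : ℝ × ℝ => 1 + (a ^ 2 - sqRadius q) / δ)
      ((-2 / δ) • (q.1 • ContinuousLinearMap.fst ℝ ℝ ℝ + q.2 • ContinuousLinearMap.snd ℝ ℝ ℝ))
      q := by
    have h1 : HasFDerivAt (fun q : ℝ × ℝ => q.1) (ContinuousLinearMap.fst ℝ ℝ ℝ) q :=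
      hasFDerivAt_fst
    have h2 : HasFDerivAt (fun q : ℝ × ℝ => q.2) (ContinuousLinearMap.snd ℝ ℝ ℝ) q :=
      hasFDerivAt_snd
    have h3 := ((((h1.pow 2).add (h2.pow 2)).const_sub (a ^ 2)).mul_const δ⁻¹).const_add 1
    have e : (fun q : ℝ × ℝ => 1 + (a ^ 2 - sqRadius q) / δ) =
        fun q => 1 + (a ^ 2 - (q.1 ^ 2 + q.2 ^ 2)) * δ⁻¹ := by
      funext q; rw [sqRadius, div_eq_mul_inv]
    rw [e]
    exact h3.congr_fderiv (by ext <;> simp <;> ring)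
  have hθ : HasDerivAt Real.smoothTransition
      (deriv Real.smoothTransition (1 + (a ^ 2 - sqRadius q) / δ))
      (1 + (a ^ 2 - sqRadius q) / δ) :=
    ((Real.smoothTransition.contDiff (n := 1)).differentiable one_ne_zero _).hasDerivAt
  exact hθ.comp_hasFDerivAt q hk

end Cutoff

section Divergence

/-- The derivative of the blend of two functions by the radial cutoff. -/
lemma hasFDerivAt_blend {A B : ℝ × ℝ → ℝ} {a δ : ℝ} {q : ℝ × ℝ} (hA : DifferentiableAt ℝ A q)
    (hB : DifferentiableAt ℝ B q) (e : ℝ × ℝ) :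
    DifferentiableAt ℝ (fun q => B q + diskCutoff a δ q * (A q - B q)) q ∧
      fderiv ℝ (fun q => B q + diskCutoff a δ q * (A q - B q)) q e =
        fderiv ℝ B q e + (diskCutoff a δ q * (fderiv ℝ A q e - fderiv ℝ B q e) +
          (A q - B q) * (deriv Real.smoothTransition (1 + (a ^ 2 - sqRadius q) / δ) *
            (-2 / δ * (q.1 * e.1 + q.2 * e.2)))) := by
  have h := hB.hasFDerivAt.add
    ((hasFDerivAt_diskCutoff a δ q).mul (hA.hasFDerivAt.sub hB.hasFDerivAt))
  have h' : HasFDerivAt (fun q => B q + diskCutoff a δ q * (A q - B q)) _ q := h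
  refine ⟨h'.differentiableAt, ?_⟩
  rw [h'.fderiv]
  simp
  ring

lemma blend_eventuallyEq_in {A B : ℝ × ℝ → ℝ} {a δ : ℝ} (hδ : 0 < δ) {q : ℝ × ℝ}
    (hq : sqRadius q < a ^ 2) :
    (fun q => B q + diskCutoff a δ q * (A q - B q)) =ᶠ[nhds q] A := by
  filter_upwards [(isOpen_lt continuous_sqRadius continuous_const).mem_nhds hq] with z hz
  rw [diskCutoff_eq_one hδ (le_of_lt hz)]; ring

lemma blend_eventuallyEq_ex {A B : ℝ × ℝ → ℝ} {a δ : ℝ} (hδ : 0 < δ) {q : ℝ × ℝ}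
    (hq : a ^ 2 + δ < sqRadius q) :
    (fun q => B q + diskCutoff a δ q * (A q - B q)) =ᶠ[nhds q] B := by
  filter_upwards [(isOpen_lt continuous_const continuous_sqRadius).mem_nhds hq] with z hz
  rw [diskCutoff_eq_zero hδ (le_of_lt hz)]; ring

/-- The divergence theorem on a rectangle, with boundary terms cancelling by periodicity. -/
lemma integral_divergence_eq_zero {τ₁ τ₂ M : ℝ} (hτ₁ : 0 < τ₁) (hτ₂ : 0 < τ₂)
    {G₁ G₂ : ℝ × ℝ → ℝ} (h₁ : ∀ q ∈ cell τ₁ τ₂, DifferentiableAt ℝ G₁ q)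
    (h₂ : ∀ q ∈ cell τ₁ τ₂, DifferentiableAt ℝ G₂ q)
    (hM : ∀ q ∈ cell τ₁ τ₂, |fderiv ℝ G₁ q (1, 0) + fderiv ℝ G₂ q (0, 1)| ≤ M)
    (hp₁ : ∀ y ∈ Icc (-τ₂ / 2) (τ₂ / 2), G₁ (τ₁ / 2, y) = G₁ (-τ₁ / 2, y))
    (hp₂ : ∀ x ∈ Icc (-τ₁ / 2) (τ₁ / 2), G₂ (x, τ₂ / 2) = G₂ (x, -τ₂ / 2)) :
    ∫ q in cell τ₁ τ₂, (fderiv ℝ G₁ q (1, 0) + fderiv ℝ G₂ q (0, 1)) = 0 := by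
  have hcell : cell τ₁ τ₂ = Icc (-τ₁ / 2, -τ₂ / 2) (τ₁ / 2, τ₂ / 2) := Icc_prod_Icc _ _ _ _
  have hle : ((-τ₁ / 2, -τ₂ / 2) : ℝ × ℝ) ≤ (τ₁ / 2, τ₂ / 2) :=
    ⟨by simp only; linarith, by simp only; linarith⟩
  have hsub : ∀ q ∈ Ioo (-τ₁ / 2) (τ₁ / 2) ×ˢ Ioo (-τ₂ / 2) (τ₂ / 2), q ∈ cell τ₁ τ₂ :=
    fun q hq => ⟨Ioo_subset_Icc_self hq.1, Ioo_subset_Icc_self hq.2⟩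
  have hmeas : Measurable fun q => fderiv ℝ G₁ q (1, 0) + fderiv ℝ G₂ q (0, 1) :=
    (measurable_fderiv_apply_const ℝ G₁ _).add (measurable_fderiv_apply_const ℝ G₂ _)
  have hcm : MeasurableSet (cell τ₁ τ₂) := measurableSet_Icc.prod measurableSet_Icc
  have hcc : IsCompact (cell τ₁ τ₂) := isCompact_Icc.prod isCompact_Icc
  have hi : IntegrableOn (fun q => fderiv ℝ G₁ q (1, 0) + fderiv ℝ G₂ q (0, 1))
      (cell τ₁ τ₂) :=
    Measure.integrableOn_of_bounded (M := M) hcc.measure_lt_top.ne hmeas.aestronglyMeasurable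
      ((ae_restrict_mem hcm).mono hM)
  have h := integral_divergence_prod_Icc_of_hasFDerivAt_of_le G₁ G₂ (fderiv ℝ G₁) (fderiv ℝ G₂)
    (-τ₁ / 2, -τ₂ / 2) (τ₁ / 2, τ₂ / 2) hle
    (by rw [← hcell]; exact fun q hq => (h₁ q hq).continuousAt.continuousWithinAt)
    (by rw [← hcell]; exact fun q hq => (h₂ q hq).continuousAt.continuousWithinAt)
    (fun q hq => (h₁ q (hsub q hq)).hasFDerivAt)
    (fun q hq => (h₂ q (hsub q hq)).hasFDerivAt)
    (by rw [← hcell]; exact hi)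
  rw [← hcell] at h
  rw [h]
  have e1 : ∫ y in (-τ₂ / 2)..(τ₂ / 2), G₁ (τ₁ / 2, y)
      = ∫ y in (-τ₂ / 2)..(τ₂ / 2), G₁ (-τ₁ / 2, y) :=
    intervalIntegral.integral_congr fun y hy => hp₁ y (by rwa [uIcc_of_le hle.2] at hy)
  have e2 : ∫ x in (-τ₁ / 2)..(τ₁ / 2), G₂ (x, τ₂ / 2)
      = ∫ x in (-τ₁ / 2)..(τ₁ / 2), G₂ (x, -τ₂ / 2) :=
    intervalIntegral.integral_congr fun x hx => hp₂ x (by rwa [uIcc_of_le hle.1] at hx)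
  simp only [e1, e2]
  ring

/-- **Divergence theorem for a field with a transmission condition**: if the normal components of
an inner and an outer field agree on a circle inside the cell, and the outer field is periodic,
then the total divergence vanishes. -/
lemma integral_glued_divergence_eq_zero {τ₁ τ₂ a : ℝ} (ha : 0 < a) (ha₁ : a < τ₁ / 2)
    (ha₂ : a < τ₂ / 2) {Nin Nex : Set (ℝ × ℝ)} (hNin : IsOpen Nin) (hNex : IsOpen Nex)
    {A₁ A₂ B₁ B₂ : ℝ × ℝ → ℝ} (hA₁ : ContDiffOn ℝ 1 A₁ Nin) (hA₂ : ContDiffOn ℝ 1 A₂ Nin)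
    (hB₁ : ContDiffOn ℝ 1 B₁ Nex) (hB₂ : ContDiffOn ℝ 1 B₂ Nex)
    (hin : ∀ q, sqRadius q ≤ a ^ 2 → q ∈ Nin)
    (hex : ∀ q ∈ cell τ₁ τ₂, a ^ 2 ≤ sqRadius q → q ∈ Nex)
    (hflux : ∀ q, sqRadius q = a ^ 2 → q.1 * A₁ q + q.2 * A₂ q = q.1 * B₁ q + q.2 * B₂ q)
    (hp₁ : ∀ y ∈ Icc (-τ₂ / 2) (τ₂ / 2), B₁ (τ₁ / 2, y) = B₁ (-τ₁ / 2, y))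
    (hp₂ : ∀ x ∈ Icc (-τ₁ / 2) (τ₁ / 2), B₂ (x, τ₂ / 2) = B₂ (x, -τ₂ / 2)) :
    ∫ q in cell τ₁ τ₂, (if sqRadius q < a ^ 2
      then fderiv ℝ A₁ q (1, 0) + fderiv ℝ A₂ q (0, 1)
      else fderiv ℝ B₁ q (1, 0) + fderiv ℝ B₂ q (0, 1)) = 0 := by
  have hcm : MeasurableSet (cell τ₁ τ₂) := measurableSet_Icc.prod measurableSet_Icc
  have hcc : IsCompact (cell τ₁ τ₂) := isCompact_Icc.prod isCompact_Icc
  set O := Ioo (-τ₁ / 2) (τ₁ / 2) ×ˢ Ioo (-τ₂ / 2) (τ₂ / 2) with hO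
  have hOc : O ⊆ cell τ₁ τ₂ := prod_mono Ioo_subset_Icc_self Ioo_subset_Icc_self
  have hdO : ∀ q, sqRadius q ≤ a ^ 2 → q ∈ O := by
    intro q hq
    have h1 : |q.1| ≤ a := abs_le_of_sq_le_sq (by unfold sqRadius at hq; nlinarith) ha.le
    have h2 : |q.2| ≤ a := abs_le_of_sq_le_sq (by unfold sqRadius at hq; nlinarith) ha.le
    rw [abs_le] at h1 h2
    exact ⟨⟨by linarith, by linarith⟩, ⟨by linarith, by linarith⟩⟩
  obtain ⟨δ₀, hδ₀, hN⟩ := exists_larger_disk_subset (hNin.inter (isOpen_Ioo.prod isOpen_Ioo))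
    (fun q hq => ⟨hin q hq, hdO q hq⟩)
  have hann : ∀ q, a ^ 2 ≤ sqRadius q → sqRadius q ≤ a ^ 2 + δ₀ → q ∈ Nin ∩ Nex :=
    fun q h1 h2 => ⟨(hN q h2).1, hex q (hOc (hN q h2).2) h1⟩
  have dA₁ : ∀ q ∈ Nin, DifferentiableAt ℝ A₁ q := fun q hq =>
    (hA₁.differentiableOn one_ne_zero).differentiableAt (hNin.mem_nhds hq)
  have dA₂ : ∀ q ∈ Nin, DifferentiableAt ℝ A₂ q := fun q hq =>
    (hA₂.differentiableOn one_ne_zero).differentiableAt (hNin.mem_nhds hq)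
  have dB₁ : ∀ q ∈ Nex, DifferentiableAt ℝ B₁ q := fun q hq =>
    (hB₁.differentiableOn one_ne_zero).differentiableAt (hNex.mem_nhds hq)
  have dB₂ : ∀ q ∈ Nex, DifferentiableAt ℝ B₂ q := fun q hq =>
    (hB₂.differentiableOn one_ne_zero).differentiableAt (hNex.mem_nhds hq)
  obtain ⟨M₁, hM₁⟩ := (isCompact_sqRadius_le (a ^ 2 + δ₀)).exists_bound_of_continuousOn
    (f := fun q => fderiv ℝ A₁ q (1, 0) + fderiv ℝ A₂ q (0, 1))
    (((hA₁.continuousOn_fderiv_of_isOpen hNin le_rfl).clm_apply continuousOn_const |>.add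
      ((hA₂.continuousOn_fderiv_of_isOpen hNin le_rfl).clm_apply continuousOn_const)).mono
      fun q hq => (hN q hq).1)
  obtain ⟨M₂, hM₂⟩ := (hcc.inter_right
      (isClosed_le continuous_const continuous_sqRadius)).exists_bound_of_continuousOn
    (f := fun q => fderiv ℝ B₁ q (1, 0) + fderiv ℝ B₂ q (0, 1))
    (((hB₁.continuousOn_fderiv_of_isOpen hNex le_rfl).clm_apply continuousOn_const |>.add
      ((hB₂.continuousOn_fderiv_of_isOpen hNex le_rfl).clm_apply continuousOn_const)).mono
      fun q hq => hex q hq.1 hq.2)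
  obtain ⟨M₃, hM₃0, hM₃⟩ := exists_abs_le_mul_sqRadius_sub (hNin.inter hNex)
    (h := fun q => q.1 * (A₁ q - B₁ q) + q.2 * (A₂ q - B₂ q))
    ((contDiff_fst.contDiffOn.mul ((hA₁.mono inter_subset_left).sub
        (hB₁.mono inter_subset_right))).add
      (contDiff_snd.contDiffOn.mul ((hA₂.mono inter_subset_left).sub
        (hB₂.mono inter_subset_right)))) ha hann
    (fun q hq => by have := hflux q hq; linarith)
  obtain ⟨Θ, hΘ⟩ := (isCompact_Icc (a := (0 : ℝ)) (b := 1)).exists_bound_of_continuousOn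
    ((Real.smoothTransition.contDiff (n := 1)).continuous_deriv le_rfl).continuousOn
  set δ : ℕ → ℝ := fun n => δ₀ / (n + 1) with hδ
  have hδ0 : ∀ n, 0 < δ n := fun n => by positivity
  have hδle : ∀ n, δ n ≤ δ₀ := fun n =>
    div_le_self hδ₀.le (by have : (0 : ℝ) ≤ n := n.cast_nonneg; linarith)
  have hδt : Filter.Tendsto δ Filter.atTop (nhds 0) := by
    have := (tendsto_one_div_add_atTop_nhds_zero_nat (𝕜 := ℝ)).const_mul δ₀
    simpa [hδ, div_eq_mul_inv] using this
  set G₁ : ℕ → ℝ × ℝ → ℝ := fun n q => B₁ q + diskCutoff a (δ n) q * (A₁ q - B₁ q) with hG₁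
  set G₂ : ℕ → ℝ × ℝ → ℝ := fun n q => B₂ q + diskCutoff a (δ n) q * (A₂ q - B₂ q) with hG₂
  set F : ℕ → ℝ × ℝ → ℝ :=
    fun n q => fderiv ℝ (G₁ n) q (1, 0) + fderiv ℝ (G₂ n) q (0, 1) with hF
  have hFin : ∀ n q, sqRadius q < a ^ 2 →
      F n q = fderiv ℝ A₁ q (1, 0) + fderiv ℝ A₂ q (0, 1) := by
    intro n q hq
    have e₁ : fderiv ℝ (G₁ n) q = fderiv ℝ A₁ q := (blend_eventuallyEq_in (hδ0 n) hq).fderiv_eq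
    have e₂ : fderiv ℝ (G₂ n) q = fderiv ℝ A₂ q := (blend_eventuallyEq_in (hδ0 n) hq).fderiv_eq
    simp only [hF]
    rw [e₁, e₂]
  have hFex : ∀ n q, a ^ 2 + δ n < sqRadius q →
      F n q = fderiv ℝ B₁ q (1, 0) + fderiv ℝ B₂ q (0, 1) := by
    intro n q hq
    have e₁ : fderiv ℝ (G₁ n) q = fderiv ℝ B₁ q := (blend_eventuallyEq_ex (hδ0 n) hq).fderiv_eq
    have e₂ : fderiv ℝ (G₂ n) q = fderiv ℝ B₂ q := (blend_eventuallyEq_ex (hδ0 n) hq).fderiv_eq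
    simp only [hF]
    rw [e₁, e₂]
  have hdiff : ∀ n, ∀ q ∈ cell τ₁ τ₂,
      DifferentiableAt ℝ (G₁ n) q ∧ DifferentiableAt ℝ (G₂ n) q := by
    intro n q hq
    rcases lt_or_ge (sqRadius q) (a ^ 2) with h | h
    · have hqN := hin q h.le
      exact ⟨(blend_eventuallyEq_in (hδ0 n) h).differentiableAt_iff.2 (dA₁ q hqN),
        (blend_eventuallyEq_in (hδ0 n) h).differentiableAt_iff.2 (dA₂ q hqN)⟩
    rcases le_or_gt (sqRadius q) (a ^ 2 + δ n) with h' | h'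
    · have hqN := hann q h (by linarith [hδle n])
      exact ⟨(hasFDerivAt_blend (dA₁ q hqN.1) (dB₁ q hqN.2) 0).1,
        (hasFDerivAt_blend (dA₂ q hqN.1) (dB₂ q hqN.2) 0).1⟩
    · have hqN := hex q hq h
      exact ⟨(blend_eventuallyEq_ex (hδ0 n) h').differentiableAt_iff.2 (dB₁ q hqN),
        (blend_eventuallyEq_ex (hδ0 n) h').differentiableAt_iff.2 (dB₂ q hqN)⟩
  have hbound : ∀ n, ∀ q ∈ cell τ₁ τ₂, |F n q| ≤ |M₁| + |M₂| + |Θ| * (2 * M₃) := by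
    intro n q hq
    have h3 : 0 ≤ |Θ| * (2 * M₃) := by positivity
    rcases lt_or_ge (sqRadius q) (a ^ 2) with h | h
    · rw [hFin n q h]
      have := hM₁ q (show sqRadius q ≤ a ^ 2 + δ₀ by linarith)
      rw [Real.norm_eq_abs] at this
      linarith [le_abs_self M₁, abs_nonneg M₂]
    rcases le_or_gt (sqRadius q) (a ^ 2 + δ n) with h' | h'
    · have h'' : sqRadius q ≤ a ^ 2 + δ₀ := by linarith [hδle n]
      have hqN := hann q h h''
      set c := diskCutoff a (δ n) q with hc
      set θ := deriv Real.smoothTransition (1 + (a ^ 2 - sqRadius q) / δ n) with hθ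
      have hc0 : 0 ≤ c := Real.smoothTransition.nonneg _
      have hc1 : c ≤ 1 := Real.smoothTransition.le_one _
      have e : F n q = (1 - c) * (fderiv ℝ B₁ q (1, 0) + fderiv ℝ B₂ q (0, 1)) +
          c * (fderiv ℝ A₁ q (1, 0) + fderiv ℝ A₂ q (0, 1)) +
          θ * (-2 / δ n * (q.1 * (A₁ q - B₁ q) + q.2 * (A₂ q - B₂ q))) := by
        simp only [hF, hG₁, hG₂]
        rw [(hasFDerivAt_blend (dA₁ q hqN.1) (dB₁ q hqN.2) (1, 0)).2,
          (hasFDerivAt_blend (dA₂ q hqN.1) (dB₂ q hqN.2) (0, 1)).2, ← hc, ← hθ]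
        ring
      have b1 := hM₁ q h''
      have b2 := hM₂ q ⟨hq, h⟩
      have b3 := hM₃ q h h''
      rw [Real.norm_eq_abs] at b1 b2
      have bθ : |θ| ≤ |Θ| := by
        refine le_trans (hΘ _ ⟨?_, ?_⟩) (le_abs_self Θ)
        · have : -1 ≤ (a ^ 2 - sqRadius q) / δ n := by
            rw [le_div_iff₀ (hδ0 n)]; linarith
          linarith
        · have : (a ^ 2 - sqRadius q) / δ n ≤ 0 :=
            div_nonpos_of_nonpos_of_nonneg (by linarith) (hδ0 n).le
          linarith
      have b4 : |-2 / δ n * (q.1 * (A₁ q - B₁ q) + q.2 * (A₂ q - B₂ q))| ≤ 2 * M₃ := by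
        rw [abs_mul, abs_div, abs_neg, abs_two, abs_of_pos (hδ0 n), div_mul_eq_mul_div,
          div_le_iff₀ (hδ0 n)]
        have : M₃ * (sqRadius q - a ^ 2) ≤ M₃ * δ n :=
          mul_le_mul_of_nonneg_left (by linarith) hM₃0
        linarith
      rw [e]
      refine (abs_add_three _ _ _).trans ?_
      rw [abs_mul, abs_mul, abs_mul θ, abs_of_nonneg hc0, abs_of_nonneg (sub_nonneg.2 hc1)]
      have t1 : (1 - c) * |fderiv ℝ B₁ q (1, 0) + fderiv ℝ B₂ q (0, 1)| ≤ |M₂| :=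
        (mul_le_of_le_one_left (abs_nonneg _) (by linarith)).trans (b2.trans (le_abs_self _))
      have t2 : c * |fderiv ℝ A₁ q (1, 0) + fderiv ℝ A₂ q (0, 1)| ≤ |M₁| :=
        (mul_le_of_le_one_left (abs_nonneg _) hc1).trans (b1.trans (le_abs_self _))
      have t3 := mul_le_mul bθ b4 (abs_nonneg _) (abs_nonneg Θ)
      linarith
    · rw [hFex n q h']
      have := hM₂ q ⟨hq, h⟩
      rw [Real.norm_eq_abs] at this
      linarith [le_abs_self M₂, abs_nonneg M₁]
  have hout : ∀ n q, q ∉ O → diskCutoff a (δ n) q = 0 := by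
    intro n q hq
    refine diskCutoff_eq_zero (hδ0 n) ?_
    by_contra! hlt
    exact hq (hN q (by linarith [hδle n])).2
  have hzero : ∀ n, ∫ q in cell τ₁ τ₂, F n q = 0 := by
    intro n
    refine integral_divergence_eq_zero (by linarith) (by linarith)
      (fun q hq => (hdiff n q hq).1) (fun q hq => (hdiff n q hq).2) (hbound n) ?_ ?_
    · intro y hy
      simp only [hG₁]
      rw [hout n _ fun h => lt_irrefl _ h.1.2, hout n _ fun h => lt_irrefl _ h.1.1, hp₁ y hy]
      ring
    · intro x hx
      simp only [hG₂]
      rw [hout n _ fun h => lt_irrefl _ h.2.2, hout n _ fun h => lt_irrefl _ h.2.1, hp₂ x hx]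
      ring
  have : IsFiniteMeasure ((volume : Measure (ℝ × ℝ)).restrict (cell τ₁ τ₂)) :=
    isFiniteMeasure_restrict.2 hcc.measure_lt_top.ne
  have hlim := tendsto_integral_of_dominated_convergence
    (μ := (volume : Measure (ℝ × ℝ)).restrict (cell τ₁ τ₂)) (F := F)
    (f := fun q => if sqRadius q < a ^ 2
      then fderiv ℝ A₁ q (1, 0) + fderiv ℝ A₂ q (0, 1)
      else fderiv ℝ B₁ q (1, 0) + fderiv ℝ B₂ q (0, 1))
    (fun _ => |M₁| + |M₂| + |Θ| * (2 * M₃))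
    (fun n => ((measurable_fderiv_apply_const ℝ (G₁ n) _).add
      (measurable_fderiv_apply_const ℝ (G₂ n) _)).aestronglyMeasurable)
    (integrable_const _)
    (fun n => (ae_restrict_mem hcm).mono fun q hq => hbound n q hq)
    (by
      filter_upwards [ae_sqRadius_ne (a ^ 2) (cell τ₁ τ₂)] with q hq
      rcases lt_or_gt_of_ne hq with h | h
      · simp only [if_pos h, hFin _ q h]
        exact tendsto_const_nhds
      · simp only [if_neg h.not_gt]
        refine tendsto_const_nhds.congr' ?_
        filter_upwards [hδt.eventually (gt_mem_nhds (sub_pos.2 h))] with n hn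
        exact (hFex n q (by linarith)).symm)
  simp only [hzero] at hlim
  exact (tendsto_nhds_unique hlim tendsto_const_nhds)

end Divergence

section EnergyField

/-- The field `c · Re (conj V ∂ₑ V)`. -/
noncomputable def energyField (c : ℝ) (V : ℝ × ℝ → ℂ) (e : ℝ × ℝ) (q : ℝ × ℝ) : ℝ :=
  c * inner ℝ (V q) (fderiv ℝ V q e)

lemma contDiffOn_fderiv_apply {V : ℝ × ℝ → ℂ} {N : Set (ℝ × ℝ)} (hN : IsOpen N)
    (hV : ContDiffOn ℝ 2 V N) (e : ℝ × ℝ) : ContDiffOn ℝ 1 (fun q => fderiv ℝ V q e) N :=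
  (hV.fderiv_of_isOpen hN (by norm_num)).clm_apply contDiffOn_const

lemma contDiffOn_energyField (c : ℝ) {V : ℝ × ℝ → ℂ} {N : Set (ℝ × ℝ)} (hN : IsOpen N)
    (hV : ContDiffOn ℝ 2 V N) (e : ℝ × ℝ) : ContDiffOn ℝ 1 (energyField c V e) N :=
  contDiffOn_const.mul ((hV.of_le (by norm_num)).inner ℝ (contDiffOn_fderiv_apply hN hV e))

lemma fderiv_energyField (c : ℝ) {V : ℝ × ℝ → ℂ} {N : Set (ℝ × ℝ)} (hN : IsOpen N)
    (hV : ContDiffOn ℝ 2 V N) (e : ℝ × ℝ) {q : ℝ × ℝ} (hq : q ∈ N) :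
    fderiv ℝ (energyField c V e) q e =
      c * (inner ℝ (V q) (fderiv ℝ (fun p => fderiv ℝ V p e) q e) + ‖fderiv ℝ V q e‖ ^ 2) := by
  have d1 : DifferentiableAt ℝ V q :=
    (hV.differentiableOn two_ne_zero).differentiableAt (hN.mem_nhds hq)
  have d2 : DifferentiableAt ℝ (fun p => fderiv ℝ V p e) q :=
    ((contDiffOn_fderiv_apply hN hV e).differentiableOn one_ne_zero).differentiableAt
      (hN.mem_nhds hq)
  have h : energyField c V e = fun p => c * (fun p => inner ℝ (V p) (fderiv ℝ V p e)) p := rfl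
  rw [h, fderiv_const_mul (d1.inner ℝ d2), smul_apply, fderiv_inner_apply ℝ d1 d2,
    real_inner_self_eq_norm_sq, smul_eq_mul]

lemma divergence_energyField (c : ℝ) {V : ℝ × ℝ → ℂ} {N : Set (ℝ × ℝ)} (hN : IsOpen N)
    (hV : ContDiffOn ℝ 2 V N) {q : ℝ × ℝ} (hq : q ∈ N) :
    fderiv ℝ (energyField c V (1, 0)) q (1, 0) + fderiv ℝ (energyField c V (0, 1)) q (0, 1) =
      c * (‖fderiv ℝ V q (1, 0)‖ ^ 2 + ‖fderiv ℝ V q (0, 1)‖ ^ 2) +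
        inner ℝ (V q) ((c : ℂ) * lap V q) := by
  rw [fderiv_energyField c hN hV _ hq, fderiv_energyField c hN hV _ hq, ← Complex.real_smul,
    inner_smul_right, lap, inner_add_right]
  ring

lemma energyField_normal (c : ℝ) (V : ℝ × ℝ → ℂ) (q : ℝ × ℝ) :
    q.1 * energyField c V (1, 0) q + q.2 * energyField c V (0, 1) q =
      inner ℝ (V q) ((c : ℂ) * fderiv ℝ V q q) := by
  have e : fderiv ℝ V q q = q.1 • fderiv ℝ V q (1, 0) + q.2 • fderiv ℝ V q (0, 1) := by
    rw [← map_smul, ← map_smul, ← map_add]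
    congr 1
    ext <;> simp
  rw [e, ← Complex.real_smul, inner_smul_right, inner_add_right, inner_smul_right,
    inner_smul_right, energyField, energyField]
  ring

lemma lap_congr {f g : ℝ × ℝ → ℂ} {q : ℝ × ℝ} (h : f =ᶠ[nhds q] g) : lap f q = lap g q := by
  have h' : ∀ e : ℝ × ℝ, (fun p => fderiv ℝ f p e) =ᶠ[nhds q] fun p => fderiv ℝ g p e :=
    fun e => (h.fderiv (𝕜 := ℝ)).mono fun p hp => by simp only [hp]
  rw [lap, lap, (h' (1, 0)).fderiv_eq, (h' (0, 1)).fderiv_eq]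

lemma exists_bound_of_contDiffOn {V : ℝ × ℝ → ℂ} {N K : Set (ℝ × ℝ)} (hN : IsOpen N)
    (hV : ContDiffOn ℝ 2 V N) (hK : IsCompact K) (hKN : K ⊆ N) :
    ∃ M, ∀ q ∈ K, ‖V q‖ ≤ M ∧ ‖fderiv ℝ V q (1, 0)‖ ≤ M ∧ ‖fderiv ℝ V q (0, 1)‖ ≤ M ∧
      ‖lap V q‖ ≤ M := by
  have c1 := contDiffOn_fderiv_apply hN hV (1, 0)
  have c2 := contDiffOn_fderiv_apply hN hV (0, 1)
  have cl : ContinuousOn (lap V) N :=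
    ((c1.continuousOn_fderiv_of_isOpen hN le_rfl).clm_apply continuousOn_const).add
      ((c2.continuousOn_fderiv_of_isOpen hN le_rfl).clm_apply continuousOn_const)
  obtain ⟨M, hM⟩ := hK.exists_bound_of_continuousOn
    (((hV.continuousOn.norm.add c1.continuousOn.norm).add c2.continuousOn.norm).add
      cl.norm |>.mono hKN)
  refine ⟨M, fun q hq => ?_⟩
  have h := (le_abs_self _).trans (hM q hq)
  simp only [Pi.add_apply] at h
  have := norm_nonneg (V q)
  have := norm_nonneg (fderiv ℝ V q (1, 0))
  have := norm_nonneg (fderiv ℝ V q (0, 1))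
  have := norm_nonneg (lap V q)
  refine ⟨?_, ?_, ?_, ?_⟩ <;> linarith

end EnergyField

section Geometry

lemma isOpen_disks (τ₁ τ₂ a : ℝ) : IsOpen (disks τ₁ τ₂ a) := by
  have e : disks τ₁ τ₂ a =
      ⋃ p ∈ centers τ₁ τ₂, {q : ℝ × ℝ | (q.1 - p.1) ^ 2 + (q.2 - p.2) ^ 2 < a ^ 2} := by
    ext q; simp [disks]
  rw [e]
  exact isOpen_biUnion fun p _ => isOpen_lt (by fun_prop) continuous_const

lemma zero_mem_centers (τ₁ τ₂ : ℝ) : ((0, 0) : ℝ × ℝ) ∈ centers τ₁ τ₂ := ⟨0, 0, by simp⟩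

lemma mem_disks_of_sqRadius_lt {τ₁ τ₂ a : ℝ} {q : ℝ × ℝ} (hq : sqRadius q < a ^ 2) :
    q ∈ disks τ₁ τ₂ a :=
  ⟨(0, 0), zero_mem_centers τ₁ τ₂, by simpa [sqRadius] using hq⟩

lemma sq_le_sq_sub_int_mul {x τ a : ℝ} (ha : 0 < a) (hτ : 0 < τ) (hx : |x| < τ - a) {m : ℤ}
    (hm : m ≠ 0) : a ^ 2 ≤ (x - m * τ) ^ 2 := by
  have h1 : (1 : ℝ) ≤ |(m : ℝ)| := by exact_mod_cast Int.one_le_abs hm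
  have h2 : τ ≤ |(m : ℝ) * τ| := by rw [abs_mul, abs_of_pos hτ]; nlinarith
  have h3 := abs_sub_abs_le_abs_sub ((m : ℝ) * τ) x
  rw [abs_sub_comm] at h3
  rw [← sq_abs (x - m * τ)]
  gcongr
  linarith

/-- Near the cell, the only disk is the one centered at the origin. -/
lemma mem_disks_iff {τ₁ τ₂ a : ℝ} (hτ₁ : 0 < τ₁) (hτ₂ : 0 < τ₂) (ha : 0 < a) {q : ℝ × ℝ}
    (h₁ : |q.1| < τ₁ - a) (h₂ : |q.2| < τ₂ - a) : q ∈ disks τ₁ τ₂ a ↔ sqRadius q < a ^ 2 := by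
  refine ⟨?_, mem_disks_of_sqRadius_lt⟩
  rintro ⟨p, ⟨m, n, rfl⟩, hp⟩
  simp only at hp
  by_cases hm : m = 0
  · by_cases hn : n = 0
    · simpa [sqRadius, hm, hn] using hp
    · have := sq_le_sq_sub_int_mul ha hτ₂ h₂ hn
      nlinarith [sq_nonneg (q.1 - m * τ₁)]
  · have := sq_le_sq_sub_int_mul ha hτ₁ h₁ hm
    nlinarith [sq_nonneg (q.2 - n * τ₂)]

lemma abs_lt_of_mem_cell {τ₁ τ₂ a : ℝ} (ha₁ : a < τ₁ / 2) (ha₂ : a < τ₂ / 2) {q : ℝ × ℝ}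
    (hq : q ∈ cell τ₁ τ₂) : |q.1| < τ₁ - a ∧ |q.2| < τ₂ - a := by
  obtain ⟨⟨h1, h2⟩, h3, h4⟩ := hq
  exact ⟨abs_lt.2 ⟨by linarith, by linarith⟩, abs_lt.2 ⟨by linarith, by linarith⟩⟩

lemma mem_closure_disks {τ₁ τ₂ a : ℝ} (ha : 0 < a) {q : ℝ × ℝ} (hq : sqRadius q ≤ a ^ 2) :
    q ∈ closure (disks τ₁ τ₂ a) := by
  have hc : Filter.Tendsto (fun t : ℝ => t • q) (nhdsWithin 1 (Iio 1)) (nhds q) := by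
    have : Continuous fun t : ℝ => t • q := by fun_prop
    simpa using (this.tendsto 1).mono_left nhdsWithin_le_nhds
  refine mem_closure_of_tendsto hc ?_
  filter_upwards [Ioo_mem_nhdsLT (zero_lt_one' ℝ)] with t ht
  refine mem_disks_of_sqRadius_lt ?_
  have e : sqRadius (t • q) = t ^ 2 * sqRadius q := by simp [sqRadius]; ring
  have h1 : t ^ 2 < 1 := by nlinarith [ht.1, ht.2]
  have h2 : 0 < a ^ 2 := by positivity
  rw [e]
  nlinarith [sq_nonneg t]

end Geometry

namespace IsTransmission

variable {τ₁ τ₂ a ε : ℝ} {v Vin Vex : ℝ × ℝ → ℂ}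

lemma eventuallyEq_in (h : IsTransmission τ₁ τ₂ a ε v Vin Vex) {q : ℝ × ℝ}
    (hq : sqRadius q < a ^ 2) : v =ᶠ[nhds q] Vin := by
  filter_upwards [(isOpen_disks τ₁ τ₂ a).mem_nhds (mem_disks_of_sqRadius_lt hq)] with z hz
  exact h.eq_in z hz

lemma eventuallyEq_ex (h : IsTransmission τ₁ τ₂ a ε v Vin Vex) (hτ₁ : 0 < τ₁) (hτ₂ : 0 < τ₂)
    (ha : 0 < a) (ha₁ : a < τ₁ / 2) (ha₂ : a < τ₂ / 2) {q : ℝ × ℝ} (hq : q ∈ cell τ₁ τ₂)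
    (hqa : a ^ 2 < sqRadius q) : v =ᶠ[nhds q] Vex := by
  obtain ⟨h1, h2⟩ := abs_lt_of_mem_cell ha₁ ha₂ hq
  have o1 : IsOpen {z : ℝ × ℝ | |z.1| < τ₁ - a} := isOpen_lt (by fun_prop) continuous_const
  have o2 : IsOpen {z : ℝ × ℝ | |z.2| < τ₂ - a} := isOpen_lt (by fun_prop) continuous_const
  filter_upwards [o1.mem_nhds h1, o2.mem_nhds h2,
    (isOpen_lt continuous_const continuous_sqRadius).mem_nhds hqa] with z hz1 hz2 hz3
  exact h.eq_ex z fun hz => lt_asymm ((mem_disks_iff hτ₁ hτ₂ ha hz1 hz2).1 hz) hz3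

lemma eq_ex_of_le (h : IsTransmission τ₁ τ₂ a ε v Vin Vex) (hτ₁ : 0 < τ₁) (hτ₂ : 0 < τ₂)
    (ha : 0 < a) (ha₁ : a < τ₁ / 2) (ha₂ : a < τ₂ / 2) {q : ℝ × ℝ} (hq : q ∈ cell τ₁ τ₂)
    (hqa : a ^ 2 ≤ sqRadius q) : q ∉ disks τ₁ τ₂ a ∧ v q = Vex q := by
  obtain ⟨h1, h2⟩ := abs_lt_of_mem_cell ha₁ ha₂ hq
  have hn : q ∉ disks τ₁ τ₂ a := fun hz => not_le_of_gt ((mem_disks_iff hτ₁ hτ₂ ha h1 h2).1 hz) hqa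
  exact ⟨hn, h.eq_ex q hn⟩

lemma eq_on_circle (h : IsTransmission τ₁ τ₂ a ε v Vin Vex) {q : ℝ × ℝ}
    (hqa : sqRadius q = a ^ 2) : Vin q = Vex q :=
  h.continuity (0, 0) (zero_mem_centers τ₁ τ₂) q (by simpa [sqRadius] using hqa)

lemma flux_on_circle (h : IsTransmission τ₁ τ₂ a ε v Vin Vex) {q : ℝ × ℝ}
    (hqa : sqRadius q = a ^ 2) :
    ((1 / ε : ℝ) : ℂ) * fderiv ℝ Vin q q = ((1 : ℝ) : ℂ) * fderiv ℝ Vex q q := by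
  have := h.flux (0, 0) (zero_mem_centers τ₁ τ₂) q (by simpa [sqRadius] using hqa)
  simpa using this

/-- A transmission function is continuous on the cell. -/
lemma continuousOn_cell (h : IsTransmission τ₁ τ₂ a ε v Vin Vex) (hτ₁ : 0 < τ₁) (hτ₂ : 0 < τ₂)
    (ha : 0 < a) (ha₁ : a < τ₁ / 2) (ha₂ : a < τ₂ / 2) : ContinuousOn v (cell τ₁ τ₂) := by
  obtain ⟨Nin, hNin, hin, hVin⟩ := h.smooth_in
  obtain ⟨Nex, hNex, hex, hVex⟩ := h.smooth_ex
  have hcl : IsClosed (cell τ₁ τ₂) := isClosed_Icc.prod isClosed_Icc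
  have c1 : ContinuousOn v (cell τ₁ τ₂ ∩ {q | sqRadius q ≤ a ^ 2}) := by
    refine (hVin.continuousOn.mono fun q hq => hin (mem_closure_disks ha hq.2)).congr
      fun q hq => ?_
    rcases lt_or_eq_of_le (show sqRadius q ≤ a ^ 2 from hq.2) with h' | h'
    · exact (h.eventuallyEq_in h').eq_of_nhds
    · rw [(h.eq_ex_of_le hτ₁ hτ₂ ha ha₁ ha₂ hq.1 h'.ge).2, h.eq_on_circle h']
  have c2 : ContinuousOn v (cell τ₁ τ₂ ∩ {q | a ^ 2 ≤ sqRadius q}) :=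
    (hVex.continuousOn.mono fun q hq =>
      hex (h.eq_ex_of_le hτ₁ hτ₂ ha ha₁ ha₂ hq.1 hq.2).1).congr
      fun q hq => (h.eq_ex_of_le hτ₁ hτ₂ ha ha₁ ha₂ hq.1 hq.2).2
  refine (c1.union_of_isClosed c2 (hcl.inter (isClosed_le continuous_sqRadius continuous_const))
    (hcl.inter (isClosed_le continuous_const continuous_sqRadius))).mono fun q hq => ?_
  rcases le_total (sqRadius q) (a ^ 2) with h' | h'
  · exact Or.inl ⟨hq, h'⟩
  · exact Or.inr ⟨hq, h'⟩

/-- Off the circle, a transmission function is differentiable on the cell, with bounded first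
derivatives and Laplacian. -/
lemma exists_bound (h : IsTransmission τ₁ τ₂ a ε v Vin Vex) (hτ₁ : 0 < τ₁) (hτ₂ : 0 < τ₂)
    (ha : 0 < a) (ha₁ : a < τ₁ / 2) (ha₂ : a < τ₂ / 2) :
    ∃ M, ∀ q ∈ cell τ₁ τ₂, sqRadius q ≠ a ^ 2 → DifferentiableAt ℝ v q ∧ ‖v q‖ ≤ M ∧
      ‖fderiv ℝ v q (1, 0)‖ ≤ M ∧ ‖fderiv ℝ v q (0, 1)‖ ≤ M ∧ ‖lap v q‖ ≤ M := by
  obtain ⟨Nin, hNin, hin, hVin⟩ := h.smooth_in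
  obtain ⟨Nex, hNex, hex, hVex⟩ := h.smooth_ex
  have hcc : IsCompact (cell τ₁ τ₂) := isCompact_Icc.prod isCompact_Icc
  obtain ⟨M₁, hM₁⟩ := exists_bound_of_contDiffOn hNin hVin (isCompact_sqRadius_le (a ^ 2))
    fun q hq => hin (mem_closure_disks ha hq)
  obtain ⟨M₂, hM₂⟩ := exists_bound_of_contDiffOn hNex hVex
    (hcc.inter_right (isClosed_le continuous_const continuous_sqRadius) :
      IsCompact (cell τ₁ τ₂ ∩ {q | a ^ 2 ≤ sqRadius q}))
    fun q hq => hex (h.eq_ex_of_le hτ₁ hτ₂ ha ha₁ ha₂ hq.1 hq.2).1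
  refine ⟨max M₁ M₂, fun q hq hqa => ?_⟩
  rcases lt_or_gt_of_ne hqa with h' | h'
  · have e := h.eventuallyEq_in h'
    obtain ⟨b1, b2, b3, b4⟩ := hM₁ q h'.le
    rw [e.eq_of_nhds, e.fderiv_eq, lap_congr e, e.differentiableAt_iff]
    exact ⟨(hVin.differentiableOn two_ne_zero).differentiableAt
      (hNin.mem_nhds (hin (mem_closure_disks ha h'.le))), le_max_of_le_left b1,
      le_max_of_le_left b2, le_max_of_le_left b3, le_max_of_le_left b4⟩
  · have e := h.eventuallyEq_ex hτ₁ hτ₂ ha ha₁ ha₂ hq h'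
    obtain ⟨b1, b2, b3, b4⟩ := hM₂ q ⟨hq, h'.le⟩
    rw [e.eq_of_nhds, e.fderiv_eq, lap_congr e, e.differentiableAt_iff]
    exact ⟨(hVex.differentiableOn two_ne_zero).differentiableAt
      (hNex.mem_nhds (hex (h.eq_ex_of_le hτ₁ hτ₂ ha ha₁ ha₂ hq h'.le).1)),
      le_max_of_le_right b1, le_max_of_le_right b2, le_max_of_le_right b3,
      le_max_of_le_right b4⟩

/-- **Energy identity** for periodic transmission functions. -/
lemma energy_identity (h : IsTransmission τ₁ τ₂ a ε v Vin Vex) (hτ₁ : 0 < τ₁) (hτ₂ : 0 < τ₂)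
    (ha : 0 < a) (ha₁ : a < τ₁ / 2) (ha₂ : a < τ₂ / 2)
    (hp₁ : ∀ r : ℝ × ℝ, v (r.1 + τ₁, r.2) = v r) (hp₂ : ∀ r : ℝ × ℝ, v (r.1, r.2 + τ₂) = v r) :
    ∫ q in cell τ₁ τ₂, (1 / epsTilde τ₁ τ₂ a ε q *
        (‖fderiv ℝ v q (1, 0)‖ ^ 2 + ‖fderiv ℝ v q (0, 1)‖ ^ 2) +
      inner ℝ (v q) ((1 / (epsTilde τ₁ τ₂ a ε q) : ℂ) * lap v q)) = 0 := by
  obtain ⟨Nin, hNin, hin, hVin⟩ := h.smooth_in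
  obtain ⟨Nex, hNex, hex, hVex⟩ := h.smooth_ex
  have hcm : MeasurableSet (cell τ₁ τ₂) := measurableSet_Icc.prod measurableSet_Icc
  have hfield : ∀ e : ℝ × ℝ, ∀ q ∈ cell τ₁ τ₂, a ^ 2 < sqRadius q →
      energyField 1 Vex e q = energyField 1 v e q := by
    intro e q hq hqa
    have e' := h.eventuallyEq_ex hτ₁ hτ₂ ha ha₁ ha₂ hq hqa
    rw [energyField, energyField, e'.eq_of_nhds, e'.fderiv_eq]
  have hper : ∀ w : ℝ × ℝ, (∀ r, v (r + w) = v r) → ∀ e q,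
      energyField 1 v e (q + w) = energyField 1 v e q := by
    intro w hw e q
    have : fderiv ℝ v (q + w) = fderiv ℝ v q := by
      rw [← fderiv_comp_add_right, funext hw]
    rw [energyField, energyField, hw, this]
  have hw₁ : ∀ r : ℝ × ℝ, v (r + (τ₁, 0)) = v r := fun r => by
    rw [← hp₁ r]; congr 1; ext <;> simp
  have hw₂ : ∀ r : ℝ × ℝ, v (r + (0, τ₂)) = v r := fun r => by
    rw [← hp₂ r]; congr 1; ext <;> simp
  have key := integral_glued_divergence_eq_zero ha ha₁ ha₂ hNin hNex
    (contDiffOn_energyField (1 / ε) hNin hVin (1, 0))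
    (contDiffOn_energyField (1 / ε) hNin hVin (0, 1))
    (contDiffOn_energyField 1 hNex hVex (1, 0)) (contDiffOn_energyField 1 hNex hVex (0, 1))
    (fun q hq => hin (mem_closure_disks ha hq))
    (fun q hq hqa => hex (h.eq_ex_of_le hτ₁ hτ₂ ha ha₁ ha₂ hq hqa).1)
    (fun q hq => by
      rw [energyField_normal, energyField_normal, h.flux_on_circle hq, h.eq_on_circle hq])
    (fun y hy => by
      have s1 : a ^ 2 < sqRadius (τ₁ / 2, y) := by
        simp only [sqRadius]; nlinarith [sq_nonneg y]
      have s2 : a ^ 2 < sqRadius (-τ₁ / 2, y) := by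
        simp only [sqRadius]; nlinarith [sq_nonneg y]
      rw [hfield _ _ ⟨⟨by simp only; linarith, le_rfl⟩, hy⟩ s1,
        hfield _ _ ⟨⟨le_rfl, by simp only; linarith⟩, hy⟩ s2, ← hper _ hw₁ _ (-τ₁ / 2, y)]
      congr 1
      ext <;> simp
      ring)
    (fun x hx => by
      have s1 : a ^ 2 < sqRadius (x, τ₂ / 2) := by
        simp only [sqRadius]; nlinarith [sq_nonneg x]
      have s2 : a ^ 2 < sqRadius (x, -τ₂ / 2) := by
        simp only [sqRadius]; nlinarith [sq_nonneg x]
      rw [hfield _ _ ⟨hx, ⟨by simp only; linarith, le_rfl⟩⟩ s1,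
        hfield _ _ ⟨hx, ⟨le_rfl, by simp only; linarith⟩⟩ s2, ← hper _ hw₂ _ (x, -τ₂ / 2)]
      congr 1
      ext <;> simp
      ring)
  refine Eq.trans (integral_congr_ae ?_) key
  filter_upwards [ae_restrict_mem hcm, ae_sqRadius_ne (a ^ 2) (cell τ₁ τ₂)] with q hq hqa
  rcases lt_or_gt_of_ne hqa with h' | h'
  · have e := h.eventuallyEq_in h'
    rw [if_pos h', divergence_energyField _ hNin hVin (hin (mem_closure_disks ha h'.le)),
      e.eq_of_nhds, e.fderiv_eq, lap_congr e, epsTilde,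
      if_pos (mem_disks_of_sqRadius_lt h' : q ∈ disks τ₁ τ₂ a)]
    push_cast
    rfl
  · have e := h.eventuallyEq_ex hτ₁ hτ₂ ha ha₁ ha₂ hq h'
    have hn := (h.eq_ex_of_le hτ₁ hτ₂ ha ha₁ ha₂ hq h'.le).1
    rw [if_neg h'.not_gt, divergence_energyField _ hNex hVex (hex hn),
      e.eq_of_nhds, e.fderiv_eq, lap_congr e, epsTilde, if_neg hn]
    norm_num

end IsTransmission

section Estimate

lemma integrableOn_cell_of_bound {F : Type*} [NormedAddCommGroup F] {τ₁ τ₂ c M : ℝ}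
    {g : ℝ × ℝ → F} (hg : AEStronglyMeasurable g (volume.restrict (cell τ₁ τ₂)))
    (hM : ∀ q ∈ cell τ₁ τ₂, sqRadius q ≠ c → ‖g q‖ ≤ M) : IntegrableOn g (cell τ₁ τ₂) := by
  have : IsFiniteMeasure (volume.restrict (cell τ₁ τ₂)) := isFiniteMeasure_restrict.2
    (isCompact_Icc.prod isCompact_Icc : IsCompact (cell τ₁ τ₂)).measure_lt_top.ne
  refine Integrable.of_bound hg M ?_
  filter_upwards [ae_restrict_mem (measurableSet_Icc.prod measurableSet_Icc),
    ae_sqRadius_ne c (cell τ₁ τ₂)] with q hq hqa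
  exact hM q hq hqa

lemma measurable_epsTilde (τ₁ τ₂ a ε : ℝ) : Measurable (epsTilde τ₁ τ₂ a ε) :=
  Measurable.ite (isOpen_disks τ₁ τ₂ a).measurableSet measurable_const measurable_const

lemma min_le_one_div_epsTilde (τ₁ τ₂ a ε : ℝ) (q : ℝ × ℝ) :
    min 1 (1 / ε) ≤ 1 / epsTilde τ₁ τ₂ a ε q := by
  unfold epsTilde
  split_ifs <;> simp

lemma one_div_epsTilde_le_max (τ₁ τ₂ a ε : ℝ) (q : ℝ × ℝ) :
    1 / epsTilde τ₁ τ₂ a ε q ≤ max 1 (1 / ε) := by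
  unfold epsTilde
  split_ifs <;> simp

lemma measurable_lap (f : ℝ × ℝ → ℂ) : Measurable (lap f) :=
  (measurable_fderiv_apply_const ℝ _ _).add (measurable_fderiv_apply_const ℝ _ _)

lemma energy_lower_bound {m κ A η : ℝ} (hm : m ≤ κ) (hA : 0 ≤ A) (hη : 0 < η) (z f : ℂ) :
    m * A - η / 2 * ‖z‖ ^ 2 - 1 / (2 * η) * ‖f‖ ^ 2 ≤ κ * A + inner ℝ z f := by
  have h1 := (abs_le.1 (abs_real_inner_le_norm z f)).1
  have h2 : ‖z‖ * ‖f‖ ≤ η / 2 * ‖z‖ ^ 2 + 1 / (2 * η) * ‖f‖ ^ 2 := by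
    have : η / 2 * ‖z‖ ^ 2 + 1 / (2 * η) * ‖f‖ ^ 2 - ‖z‖ * ‖f‖ =
        (η * ‖z‖ - ‖f‖) ^ 2 / (2 * η) := by
      field_simp
      ring
    have h3 : 0 ≤ (η * ‖z‖ - ‖f‖) ^ 2 / (2 * η) := by positivity
    linarith
  have h3 := mul_le_mul_of_nonneg_right hm hA
  linarith

lemma poincare_cell {τ₁ τ₂ a ε : ℝ} {v Vin Vex : ℝ × ℝ → ℂ}
    (h : IsTransmission τ₁ τ₂ a ε v Vin Vex) (hτ₁ : 0 < τ₁) (hτ₂ : 0 < τ₂)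
    (ha : 0 < a) (ha₁ : a < τ₁ / 2) (ha₂ : a < τ₂ / 2) (h0 : ∫ r in cell τ₁ τ₂, v r = 0) :
    ∫ q in cell τ₁ τ₂, ‖v q‖ ^ 2 ≤
      2 * τ₁ ^ 2 * (∫ q in cell τ₁ τ₂, ‖fderiv ℝ v q (1, 0)‖ ^ 2) +
        2 * τ₂ ^ 2 * ∫ q in cell τ₁ τ₂, ‖fderiv ℝ v q (0, 1)‖ ^ 2 := by
  obtain ⟨M, hM⟩ := h.exists_bound hτ₁ hτ₂ ha ha₁ ha₂
  have := poincare_rectangle (by linarith : -τ₁ / 2 < τ₁ / 2) (by linarith : -τ₂ / 2 < τ₂ / 2)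
    (measurableSet_circle (a ^ 2)) (countable_circle_slice_fst (a ^ 2))
    (countable_circle_slice_snd (a ^ 2)) (h.continuousOn_cell hτ₁ hτ₂ ha ha₁ ha₂)
    (fun q hq hqa => (hM q hq hqa).1) (fun q hq hqa => (hM q hq hqa).2.2.1)
    (fun q hq hqa => (hM q hq hqa).2.2.2.1) h0
  rwa [show τ₁ / 2 - -τ₁ / 2 = τ₁ by ring, show τ₂ / 2 - -τ₂ / 2 = τ₂ by ring] at this

end Estimate

/-- **A priori estimate, uniform in the inclusion radius `a`**: for a doubly
periodic transmission function `v` of zero mean,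
`‖v‖²_{H¹(S)} ≤ C ‖(1/ε̃)Δv‖²_{L²(S)}` with `C` independent of `a`. -/
theorem apriori_estimate (τ₁ τ₂ ε : ℝ) (hτ₁ : 0 < τ₁) (hτ₂ : 0 < τ₂) (hε : 0 < ε) :
    ∃ C > (0:ℝ), ∀ a : ℝ, 0 < a → a < min τ₁ τ₂ / 2 →
      ∀ v Vin Vex : ℝ × ℝ → ℂ,
        IsTransmission τ₁ τ₂ a ε v Vin Vex →
        (∀ r : ℝ × ℝ, v (r.1 + τ₁, r.2) = v r) →
        (∀ r : ℝ × ℝ, v (r.1, r.2 + τ₂) = v r) →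
        (∫ r in cell τ₁ τ₂, v r) = 0 →
        ∫ r in cell τ₁ τ₂,
            (‖v r‖ ^ 2 + ‖fderiv ℝ v r (1, 0)‖ ^ 2 + ‖fderiv ℝ v r (0, 1)‖ ^ 2) ≤
          C * ∫ r in cell τ₁ τ₂, ‖(1 / (epsTilde τ₁ τ₂ a ε r) : ℂ) * lap v r‖ ^ 2 := by

  set P : ℝ := 2 * τ₁ ^ 2 + 2 * τ₂ ^ 2 with hP
  set m : ℝ := min 1 (1 / ε) with hm
  have hP0 : 0 < P := by positivity
  have hm0 : 0 < m := lt_min one_pos (by positivity)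
  refine ⟨(1 + P) * P / m ^ 2, by positivity, ?_⟩
  intro a ha ham v Vin Vex h hp₁ hp₂ h0
  have ha₁ : a < τ₁ / 2 := ham.trans_le (by gcongr; exact min_le_left _ _)
  have ha₂ : a < τ₂ / 2 := ham.trans_le (by gcongr; exact min_le_right _ _)
  have hcm : MeasurableSet (cell τ₁ τ₂) := measurableSet_Icc.prod measurableSet_Icc
  have hen := h.energy_identity hτ₁ hτ₂ ha ha₁ ha₂ hp₁ hp₂
  have hpo := poincare_cell h hτ₁ hτ₂ ha ha₁ ha₂ h0
  obtain ⟨M, hM⟩ := h.exists_bound hτ₁ hτ₂ ha ha₁ ha₂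
  set f : ℝ × ℝ → ℂ := fun q => (1 / (epsTilde τ₁ τ₂ a ε q) : ℂ) * lap v q with hf
  have hκm : Measurable fun q => 1 / epsTilde τ₁ τ₂ a ε q :=
    (measurable_epsTilde τ₁ τ₂ a ε).const_div 1
  have hfm : Measurable f :=
    (Complex.measurable_ofReal.comp (measurable_epsTilde τ₁ τ₂ a ε)).const_div 1 |>.mul
      (measurable_lap v)
  have hvm : AEStronglyMeasurable v (volume.restrict (cell τ₁ τ₂)) :=
    (h.continuousOn_cell hτ₁ hτ₂ ha ha₁ ha₂).aestronglyMeasurable hcm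
  have hxm : Measurable fun q => fderiv ℝ v q (1, 0) := measurable_fderiv_apply_const ℝ _ _
  have hym : Measurable fun q => fderiv ℝ v q (0, 1) := measurable_fderiv_apply_const ℝ _ _
  have hκ0 : ∀ q, 0 ≤ 1 / epsTilde τ₁ τ₂ a ε q := fun q =>
    hm0.le.trans (min_le_one_div_epsTilde τ₁ τ₂ a ε q)
  have hfb : ∀ q ∈ cell τ₁ τ₂, sqRadius q ≠ a ^ 2 → ‖f q‖ ≤ max 1 (1 / ε) * M := by
    intro q hq hqa
    have e : ‖(1 / (epsTilde τ₁ τ₂ a ε q) : ℂ)‖ = 1 / epsTilde τ₁ τ₂ a ε q := by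
      rw [← Complex.ofReal_one, ← Complex.ofReal_div, Complex.norm_real,
        Real.norm_of_nonneg (hκ0 q)]
    rw [hf]
    simp only [norm_mul, e]
    exact mul_le_mul (one_div_epsTilde_le_max τ₁ τ₂ a ε q) (hM q hq hqa).2.2.2.2
      (norm_nonneg _) (by positivity)
  have hsq : ∀ {g : ℝ × ℝ → ℂ} {B : ℝ}, AEStronglyMeasurable g (volume.restrict (cell τ₁ τ₂)) →
      (∀ q ∈ cell τ₁ τ₂, sqRadius q ≠ a ^ 2 → ‖g q‖ ≤ B) →
      IntegrableOn (fun q => ‖g q‖ ^ 2) (cell τ₁ τ₂) := by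
    intro g B hg hB
    refine integrableOn_cell_of_bound (c := a ^ 2) (M := B ^ 2) (hg.norm.pow 2) fun q hq hqa => ?_
    rw [norm_pow, norm_norm]
    exact pow_le_pow_left₀ (norm_nonneg _) (hB q hq hqa) 2
  have iv := hsq hvm fun q hq hqa => (hM q hq hqa).2.1
  have ix := hsq hxm.aestronglyMeasurable fun q hq hqa => (hM q hq hqa).2.2.1
  have iy := hsq hym.aestronglyMeasurable fun q hq hqa => (hM q hq hqa).2.2.2.1
  have jf := hsq hfm.aestronglyMeasurable hfb
  have iE : IntegrableOn (fun q => 1 / epsTilde τ₁ τ₂ a ε q *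
        (‖fderiv ℝ v q (1, 0)‖ ^ 2 + ‖fderiv ℝ v q (0, 1)‖ ^ 2) + inner ℝ (v q) (f q))
      (cell τ₁ τ₂) := by
    refine Integrable.add ?_ ?_
    · refine (ix.add iy).bdd_mul (c := max 1 (1 / ε)) hκm.aestronglyMeasurable
        (Filter.Eventually.of_forall fun q => ?_)
      rw [Real.norm_of_nonneg (hκ0 q)]
      exact one_div_epsTilde_le_max τ₁ τ₂ a ε q
    · refine integrableOn_cell_of_bound (c := a ^ 2) (M := M * (max 1 (1 / ε) * M))
        (hvm.inner hfm.aestronglyMeasurable) fun q hq hqa => ?_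
      exact (norm_inner_le_norm _ _).trans (mul_le_mul (hM q hq hqa).2.1 (hfb q hq hqa)
        (norm_nonneg _) ((norm_nonneg _).trans (hM q hq hqa).2.1))
  set V := ∫ q in cell τ₁ τ₂, ‖v q‖ ^ 2
  set X := ∫ q in cell τ₁ τ₂, ‖fderiv ℝ v q (1, 0)‖ ^ 2
  set Y := ∫ q in cell τ₁ τ₂, ‖fderiv ℝ v q (0, 1)‖ ^ 2
  set J := ∫ q in cell τ₁ τ₂, ‖f q‖ ^ 2
  have hX : 0 ≤ X := integral_nonneg fun q => by positivity
  have hY : 0 ≤ Y := integral_nonneg fun q => by positivity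
  have hη : 0 < m / P := by positivity
  have hle : m * (X + Y) - m / P / 2 * V - 1 / (2 * (m / P)) * J ≤ 0 := by
    have i1 := (ix.add iy).const_mul m
    have i2 := iv.const_mul (m / P / 2)
    have i3 := jf.const_mul (1 / (2 * (m / P)))
    have key := integral_mono_ae ((i1.sub i2).sub i3) iE (Filter.Eventually.of_forall fun q =>
      energy_lower_bound (min_le_one_div_epsTilde τ₁ τ₂ a ε q)
        (add_nonneg (sq_nonneg ‖fderiv ℝ v q (1, 0)‖) (sq_nonneg ‖fderiv ℝ v q (0, 1)‖))
        hη (v q) (f q))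
    rw [hen, integral_sub' (i1.sub i2) i3, integral_sub' i1 i2, integral_const_mul,
      integral_const_mul, integral_const_mul, integral_add' ix iy] at key
    exact key
  have hVP : V ≤ P * (X + Y) := by
    rw [hP]
    nlinarith [mul_nonneg (sq_nonneg τ₁) hY, mul_nonneg (sq_nonneg τ₂) hX]
  have hI : X + Y ≤ P / m ^ 2 * J := by
    have e1 : m / P / 2 * V ≤ m / 2 * (X + Y) := by
      calc m / P / 2 * V ≤ m / P / 2 * (P * (X + Y)) := by gcongr
        _ = m / 2 * (X + Y) := by field_simp
    have e2 : 1 / (2 * (m / P)) * J = m / 2 * (P / m ^ 2 * J) := by field_simp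
    nlinarith
  have hsplit : ∫ r in cell τ₁ τ₂,
      (‖v r‖ ^ 2 + ‖fderiv ℝ v r (1, 0)‖ ^ 2 + ‖fderiv ℝ v r (0, 1)‖ ^ 2) = V + X + Y := by
    rw [← integral_add' iv ix, ← integral_add' (iv.add ix) iy]
    rfl
  calc ∫ r in cell τ₁ τ₂,
        (‖v r‖ ^ 2 + ‖fderiv ℝ v r (1, 0)‖ ^ 2 + ‖fderiv ℝ v r (0, 1)‖ ^ 2)
      = V + X + Y := hsplit
    _ ≤ (1 + P) * (X + Y) := by linarith
    _ ≤ (1 + P) * (P / m ^ 2 * J) := by gcongr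
    _ = (1 + P) * P / m ^ 2 * J := by ring
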